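/- Let ρ ⊆ Dⁿ, n ≥ 2, be a relation on D = {0,1,2}. If ρ has an essential tuple of the form (2, 2, x_3, …, x_n), then ρ is not preserved by the operation s. -/

import Mathlib

/-- The three-element domain. -/
abbrev D : Type := Fin 3

/-- A finitary operation on `D`, packaged with its arity. -/
abbrev Op : Type := Σ n : ℕ, (Fin n → D) → D

/-- The semilattice-without-unit operation `s`: `s(x,x) = x`, `s(x,y) = 2` for `x ≠ y`. -/
def sFun : (Fin 2 → D) → D := fun x => if x 0 = x 1 then x 0 else 2

/-- `s` as a packaged operation. -/
def sOp : Op := ⟨2, sFun⟩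

/-- The clone generated by a set `F` of operations on `D`: the smallest set of
operations containing `F` and all projections and closed under composition. -/
inductive InClone (F : Set Op) : Op → Prop
  | base {g : Op} : g ∈ F → InClone F g
  | proj {n : ℕ} (i : Fin n) : InClone F ⟨n, fun x => x i⟩
  | comp {n m : ℕ} (f : (Fin n → D) → D) (g : Fin n → (Fin m → D) → D) :
      InClone F ⟨n, f⟩ → (∀ i, InClone F ⟨m, g i⟩) →
      InClone F ⟨m, fun x => f (fun i => g i x)⟩

/-- Closure of a set `S ⊆ D^m` under coordinatewise applications of operations
of the clone generated by `F`. -/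
inductive InClosure (F : Set Op) {m : ℕ} (S : Set (Fin m → D)) : (Fin m → D) → Prop
  | base {t : Fin m → D} : t ∈ S → InClosure F S t
  | app {n : ℕ} (f : (Fin n → D) → D) (ts : Fin n → Fin m → D) :
      InClone F ⟨n, f⟩ → (∀ i, InClosure F S (ts i)) →
      InClosure F S (fun j => f (fun i => ts i j))

/-- `Λ_{m,k}`: the tuples of `D^m` in which at least `m - k` coordinates are equal. -/
def Lam (m k : ℕ) : Set (Fin m → D) :=
  {x | ∃ a : D, m - k ≤ Set.ncard {i : Fin m | x i = a}}

/-- `F` is `k`-collapsible. -/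
def KCollapsible (F : Set Op) (k : ℕ) : Prop :=
  ∀ m : ℕ, 1 ≤ m → ∀ t : Fin m → D, InClosure F (Lam m k) t

/-- `F` is collapsible: `k`-collapsible for some `k`. -/
def Collapsible (F : Set Op) : Prop := ∃ k, KCollapsible F k

/-- An operation is idempotent. -/
def Idem {n : ℕ} (g : (Fin n → D) → D) : Prop := ∀ x : D, g (fun _ => x) = x

/-- An operation preserves a subset `B ⊆ D`. -/
def PreservesSet {n : ℕ} (g : (Fin n → D) → D) (B : Set D) : Prop :=
  ∀ x : Fin n → D, (∀ i, x i ∈ B) → g x ∈ B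

/-- A tuple lies in `{0,1}^n`. -/
def Bool01 {n : ℕ} (x : Fin n → D) : Prop := ∀ j, x j = 0 ∨ x j = 1

/-- Property (*): for each coordinate `i` there is `x ∈ {0,1}^k` with
`f(x) ∈ {0,1}` and `f(x) ≠ x_i`. -/
def PropStar {k : ℕ} (f : (Fin k → D) → D) : Prop :=
  ∀ i : Fin k, ∃ x : Fin k → D, Bool01 x ∧ (f x = 0 ∨ f x = 1) ∧ f x ≠ x i

/-- Class (i): coordinates with a `0 ↦ 1` witness but no `1 ↦ 0` witness. -/
def ClassI {k : ℕ} (f : (Fin k → D) → D) : Set (Fin k) :=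
  {i | (∃ x, Bool01 x ∧ x i = 0 ∧ f x = 1) ∧ ¬ ∃ x, Bool01 x ∧ x i = 1 ∧ f x = 0}

/-- Class (ii): coordinates with a `1 ↦ 0` witness but no `0 ↦ 1` witness. -/
def ClassII {k : ℕ} (f : (Fin k → D) → D) : Set (Fin k) :=
  {i | (∃ x, Bool01 x ∧ x i = 1 ∧ f x = 0) ∧ ¬ ∃ x, Bool01 x ∧ x i = 0 ∧ f x = 1}

/-- A tuple `a` is essential for `ρ`: `a ∉ ρ` and changing any single coordinate can
bring it into `ρ`. -/
def IsEssentialTuple {n : ℕ} (ρ : Set (Fin n → D)) (a : Fin n → D) : Prop :=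
  a ∉ ρ ∧ ∀ i : Fin n, ∃ b : D, Function.update a i b ∈ ρ

theorem statement6 {n : ℕ} (hn : 2 ≤ n) (ρ : Set (Fin n → D))
    (a : Fin n → D) (ha : IsEssentialTuple ρ a)
    (h0 : a ⟨0, by omega⟩ = 2) (h1 : a ⟨1, by omega⟩ = 2) :
    ¬ ∀ t ∈ ρ, ∀ t' ∈ ρ, (fun i => sFun ![t i, t' i]) ∈ ρ := by
  intro hs
  obtain ⟨ha_notMem, ha_update⟩ := ha
  obtain ⟨b, hb⟩ := ha_update ⟨0, by omega⟩
  obtain ⟨c, hc⟩ := ha_update ⟨1, by omega⟩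
  refine ha_notMem ?_
  convert hs _ hb _ hc using 1
  funext i
  by_cases hi0 : i = ⟨0, by omega⟩
  · subst hi0
    simp [sFun, h0, eq_comm]
  · by_cases hi1 : i = ⟨1, by omega⟩
    · subst hi1
      simp [sFun, h1]
    · simp [sFun, hi0, hi1]
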